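/- Let (m_j)_{j≥1} be a sequence of positive integers with m_{j+1} ≥ 3·m_j for all j. Then: (i) the map sending a pair (j, (ξ_1,…,ξ_{j−1})) with ξ_l ∈ {−1,0,1} to the lattice point ((−1)^{j−1}m_j, m_j) + Σ_{l=1}^{j−1} ξ_l·((−1)^{l−1}m_l, m_l) ∈ ℤ² is injective, the sets M_j and −M_j (over all j) are pairwise disjoint, and 0 ∉ M_j; hence ‖k‖₀ := 1 + Σ_{l=1}^{j−1}|ξ_l| is well defined for k ∈ ±M_j. (ii) For every n ≥ 1 and all (s,t) ∈ ℝ²: ∏_{j=1}^{n} [ 1 + cos(2π·m_j·((−1)^{j−1}s + t)) ] = 1 + Σ_{j=1}^{n} Σ_{k=(k₁,k₂) ∈ ±M_j} 2^{−‖k‖₀}·e^{2πi(k₁s + k₂t)}. -/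

import Mathlib

open scoped Real

noncomputable section

/-- The base lattice vector `((−1)^{l−1} m_l, m_l) ∈ ℤ²`. -/
def baseVec (m : ℕ → ℕ) (l : ℕ) : ℤ × ℤ :=
  ((-1 : ℤ) ^ (l - 1) * (m l : ℤ), (m l : ℤ))

/-- The element of `M_j` corresponding to the sign pattern `ξ`
(signs `ξ_l ∈ {−1,0,1}` parametrised by `Fin 3` via `ξ ↦ ξ − 1`):
`((−1)^{j−1}m_j, m_j) + Σ_{l=1}^{j−1} ξ_l ((−1)^{l−1}m_l, m_l)`. -/
def latticePt (m : ℕ → ℕ) (j : ℕ) (ξ : Fin (j - 1) → Fin 3) : ℤ × ℤ :=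
  baseVec m j + ∑ l : Fin (j - 1), (((ξ l : ℕ) : ℤ) - 1) • baseVec m ((l : ℕ) + 1)

/-- The number of nonzero signs in a sign pattern, so that `‖k‖₀ = 1 + nzCount ξ`. -/
def nzCount {r : ℕ} (ξ : Fin r → Fin 3) : ℕ :=
  (Finset.univ.filter fun l => ξ l ≠ 1).card

/-- A signed sum of the first `r` terms of a lacunary sequence is less than half the next term. -/
theorem two_mul_abs_sum_lt {m : ℕ → ℕ} (hm : ∀ j, 1 ≤ m j) (hlac : ∀ j, 3 * m j ≤ m (j + 1)) :
    ∀ {r : ℕ} (x : Fin r → ℤ), (∀ l, |x l| ≤ 1) →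
      2 * |∑ l : Fin r, x l * (m ((l : ℕ) + 1) : ℤ)| < m (r + 1)
  | 0, _, _ => by simpa using Nat.succ_le_iff.1 (hm 1)
  | r + 1, x, hx => by
    have ih := two_mul_abs_sum_lt hm hlac (fun l : Fin r => x l.castSucc) fun l => hx _
    have hl : 3 * (m (r + 1) : ℤ) ≤ m (r + 1 + 1) := by exact_mod_cast hlac (r + 1)
    have hlast : |x (Fin.last r) * (m (r + 1) : ℤ)| ≤ m (r + 1) := by
      rw [abs_mul, Nat.abs_cast]
      exact mul_le_of_le_one_left (by positivity) (hx _)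
    rw [Fin.sum_univ_castSucc]
    simp only [Fin.val_castSucc, Fin.val_last]
    have := abs_add_le (∑ l : Fin r, x l.castSucc * (m ((l : ℕ) + 1) : ℤ))
      (x (Fin.last r) * (m (r + 1) : ℤ))
    linarith

/-- Signed sums of terms of a lacunary sequence determine the signs. -/
theorem signs_eq_of_sum_eq {m : ℕ → ℕ} (hm : ∀ j, 1 ≤ m j) (hlac : ∀ j, 3 * m j ≤ m (j + 1)) :
    ∀ {r : ℕ} (x y : Fin r → ℤ), (∀ l, |x l| ≤ 1) → (∀ l, |y l| ≤ 1) →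
      ∑ l : Fin r, x l * (m ((l : ℕ) + 1) : ℤ) = ∑ l : Fin r, y l * (m ((l : ℕ) + 1) : ℤ) →
      x = y
  | 0, _, _, _, _, _ => Subsingleton.elim _ _
  | r + 1, x, y, hx, hy, h => by
    have hX := two_mul_abs_sum_lt hm hlac (fun l : Fin r => x l.castSucc) fun l => hx _
    have hY := two_mul_abs_sum_lt hm hlac (fun l : Fin r => y l.castSucc) fun l => hy _
    rw [Fin.sum_univ_castSucc, Fin.sum_univ_castSucc] at h
    simp only [Fin.val_castSucc, Fin.val_last] at h
    have hpos : (0 : ℤ) < m (r + 1) := by exact_mod_cast hm (r + 1)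
    have hlt : |x (Fin.last r) - y (Fin.last r)| * (m (r + 1) : ℤ) < 1 * m (r + 1) := by
      rw [← abs_of_pos hpos, ← abs_mul, abs_of_pos hpos, abs_lt]
      obtain ⟨h1, h2⟩ := abs_le.1 (le_refl |∑ l : Fin r, x l.castSucc * (m ((l : ℕ) + 1) : ℤ)|)
      obtain ⟨h3, h4⟩ := abs_le.1 (le_refl |∑ l : Fin r, y l.castSucc * (m ((l : ℕ) + 1) : ℤ)|)
      constructor <;> linarith
    have hlast : x (Fin.last r) = y (Fin.last r) :=
      sub_eq_zero.1 (Int.abs_lt_one_iff.1 (lt_of_mul_lt_mul_right hlt hpos.le))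
    rw [hlast, add_left_inj] at h
    have ih := signs_eq_of_sum_eq hm hlac (fun l : Fin r => x l.castSucc)
      (fun l => y l.castSucc) (fun l => hx _) (fun l => hy _) h
    funext l
    exact Fin.lastCases hlast (congrFun ih) l

theorem abs_fin_three_sub_one_le (a : Fin 3) : |((a : ℕ) : ℤ) - 1| ≤ 1 := by
  fin_cases a <;> simp

theorem latticePt_snd (m : ℕ → ℕ) (j : ℕ) (ξ : Fin (j - 1) → Fin 3) :
    (latticePt m j ξ).2 =
      m j + ∑ l : Fin (j - 1), (((ξ l : ℕ) : ℤ) - 1) * (m ((l : ℕ) + 1) : ℤ) := by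
  simp [latticePt, baseVec, Prod.snd_sum]

/-- The second coordinate of a point of `M_j` lies strictly between `m_j / 2` and `3 m_j / 2`. -/
theorem latticePt_snd_mem {m : ℕ → ℕ} (hm : ∀ j, 1 ≤ m j) (hlac : ∀ j, 3 * m j ≤ m (j + 1))
    {j : ℕ} (hj : 1 ≤ j) (ξ : Fin (j - 1) → Fin 3) :
    (m j : ℤ) < 2 * (latticePt m j ξ).2 ∧ 2 * (latticePt m j ξ).2 < 3 * m j := by
  have h := two_mul_abs_sum_lt hm hlac (fun l : Fin (j - 1) => ((ξ l : ℕ) : ℤ) - 1)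
    fun l => abs_fin_three_sub_one_le _
  rw [Nat.sub_add_cancel hj] at h
  rw [latticePt_snd]
  obtain ⟨h1, h2⟩ := abs_le.1
    (le_refl |∑ l : Fin (j - 1), (((ξ l : ℕ) : ℤ) - 1) * (m ((l : ℕ) + 1) : ℤ)|)
  constructor <;> linarith

theorem three_mul_le_of_lt {m : ℕ → ℕ} (hlac : ∀ j, 3 * m j ≤ m (j + 1)) {j j' : ℕ}
    (h : j < j') : 3 * m j ≤ m j' :=
  (hlac j).trans (monotone_nat_of_le_succ (fun i => by have := hlac i; omega) h)

theorem index_le_of_latticePt_eq {m : ℕ → ℕ} (hm : ∀ j, 1 ≤ m j)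
    (hlac : ∀ j, 3 * m j ≤ m (j + 1)) {j j' : ℕ} (hj : 1 ≤ j) (hj' : 1 ≤ j')
    {ξ : Fin (j - 1) → Fin 3} {ξ' : Fin (j' - 1) → Fin 3}
    (h : latticePt m j ξ = latticePt m j' ξ') : j' ≤ j := by
  by_contra! hlt
  have h1 := (latticePt_snd_mem hm hlac hj ξ).2
  have h2 := (latticePt_snd_mem hm hlac hj' ξ').1
  have := three_mul_le_of_lt hlac hlt
  rw [h] at h1
  omega

theorem latticePt_injective {m : ℕ → ℕ} (hm : ∀ j, 1 ≤ m j)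
    (hlac : ∀ j, 3 * m j ≤ m (j + 1)) (j : ℕ) : Function.Injective (latticePt m j) := by
  intro ξ ξ' h
  have h2 := congrArg Prod.snd h
  rw [latticePt_snd, latticePt_snd, add_right_inj] at h2
  have := signs_eq_of_sum_eq hm hlac _ _ (fun l => abs_fin_three_sub_one_le (ξ l))
    (fun l => abs_fin_three_sub_one_le (ξ' l)) h2
  funext l
  have := congrFun this l
  exact Fin.ext (by simpa using this)

/-- Expansion of a Riesz product along a character `ψ`. -/
theorem prod_one_add_addChar {A : Type*} [AddCommGroup A] (ψ : AddChar A ℂ) {r : ℕ}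
    (b : Fin r → A) :
    ∏ l, (1 + (ψ (b l) + ψ (-b l)) / 2) =
      ∑ ξ : Fin r → Fin 3, (1 / 2 : ℂ) ^ nzCount ξ *
        ψ (∑ l, (((ξ l : ℕ) : ℤ) - 1) • b l) := by
  have hfactor (l : Fin r) : 1 + (ψ (b l) + ψ (-b l)) / 2 =
      ∑ a : Fin 3, (if a ≠ 1 then (1 / 2 : ℂ) else 1) * ψ ((((a : ℕ) : ℤ) - 1) • b l) := by
    simp [Fin.sum_univ_three]
    ring
  simp_rw [hfactor, Fintype.prod_sum, Finset.prod_mul_distrib]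
  refine Finset.sum_congr rfl fun ξ _ => ?_
  have hsum := map_prod ψ.toMonoidHom (fun l => Multiplicative.ofAdd ((((ξ l : ℕ) : ℤ) - 1) • b l))
    Finset.univ
  simp only [← ofAdd_sum, AddChar.toMonoidHom_apply, toAdd_ofAdd] at hsum
  rw [hsum, ← Finset.prod_filter, Finset.prod_const, nzCount]

/-- The character `k ↦ e^{2πi(k₁s + k₂t)}` of `ℤ²`. -/
def expChar (s t : ℝ) : AddChar (ℤ × ℤ) ℂ where
  toFun k := Complex.exp (2 * (π : ℂ) * Complex.I * ((k.1 : ℂ) * (s : ℂ) + (k.2 : ℂ) * (t : ℂ)))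
  map_zero_eq_one' := by simp
  map_add_eq_mul' k k' := by
    rw [← Complex.exp_add]
    congr 1
    push_cast [Prod.fst_add, Prod.snd_add]
    ring

theorem expChar_apply (s t : ℝ) (k : ℤ × ℤ) : expChar s t k =
    Complex.exp (2 * (π : ℂ) * Complex.I * ((k.1 : ℂ) * (s : ℂ) + (k.2 : ℂ) * (t : ℂ))) :=
  rfl

theorem cos_eq_expChar (m : ℕ → ℕ) (s t : ℝ) (j : ℕ) :
    ((Real.cos (2 * π * (m j : ℝ) * ((-1 : ℝ) ^ (j - 1) * s + t)) : ℝ) : ℂ) =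
      (expChar s t (baseVec m j) + expChar s t (-baseVec m j)) / 2 := by
  rw [Complex.ofReal_cos, Complex.cos, expChar_apply, expChar_apply]
  congr 3 <;>
  · simp only [baseVec, Prod.fst_neg, Prod.snd_neg]
    push_cast
    ring

theorem sum_expChar_smul_latticePt (m : ℕ → ℕ) (s t : ℝ) (j : ℕ) :
    ∑ ξ : Fin (j - 1) → Fin 3, ∑ σ ∈ ({-1, 1} : Finset ℤ),
        (1 / 2 : ℂ) ^ (1 + nzCount ξ) * expChar s t (σ • latticePt m j ξ) =
      (expChar s t (baseVec m j) + expChar s t (-baseVec m j)) / 2 *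
        ∏ l : Fin (j - 1), (1 + (expChar s t (baseVec m ((l : ℕ) + 1)) +
          expChar s t (-baseVec m ((l : ℕ) + 1))) / 2) := by
  have hpos := prod_one_add_addChar (expChar s t)
    fun l : Fin (j - 1) => baseVec m ((l : ℕ) + 1)
  have hneg := prod_one_add_addChar (expChar s t)
    fun l : Fin (j - 1) => -baseVec m ((l : ℕ) + 1)
  simp_rw [neg_neg, add_comm (expChar s t (-baseVec m _))] at hneg
  rw [add_div, add_mul]
  nth_rewrite 1 [hpos]
  rw [hneg, Finset.mul_sum, Finset.mul_sum, ← Finset.sum_add_distrib]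
  refine Finset.sum_congr rfl fun ξ _ => ?_
  rw [Finset.sum_pair (by decide), neg_one_smul, one_smul, latticePt, neg_add,
    ← Finset.sum_neg_distrib]
  simp only [AddChar.map_add_eq_mul, smul_neg, pow_add, pow_one]
  ring

/-- Telescoping expansion of a product of factors `1 + c_j`. -/
theorem prod_Icc_one_add {R : Type*} [CommSemiring R] (c : ℕ → R) (n : ℕ) :
    ∏ j ∈ Finset.Icc 1 n, (1 + c j) =
      1 + ∑ j ∈ Finset.Icc 1 n, c j * ∏ l : Fin (j - 1), (1 + c ((l : ℕ) + 1)) := by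
  induction n with
  | zero => simp
  | succ n ih =>
    rw [Finset.sum_Icc_succ_top (by omega), ← add_assoc, ← ih,
      Finset.prod_Icc_succ_top (by omega), Nat.add_sub_cancel,
      Fin.prod_univ_eq_prod_range (fun l => 1 + c (l + 1)) n, Finset.range_eq_Ico,
      Finset.prod_Ico_add' (fun l => 1 + c l) 0 n 1, zero_add, Finset.Ico_add_one_right_eq_Icc]
    ring

/-- For a lacunary sequence `(m_j)` (`m_{j+1} ≥ 3 m_j`):
(i) the map `(j, ξ) ↦ ((−1)^{j−1}m_j, m_j) + Σ ξ_l ((−1)^{l−1}m_l, m_l)` is injective, the sets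
`M_j` and `−M_j` are pairwise disjoint and do not contain `0`;
(ii) the classical finite Riesz product factorisation
`∏_{j=1}^{n} (1 + cos(2π m_j ((−1)^{j−1}s + t)))
  = 1 + Σ_{j=1}^{n} Σ_{k ∈ ±M_j} 2^{−‖k‖₀} e^{2πi(k₁s+k₂t)}` holds. -/
theorem stmt_18 (m : ℕ → ℕ) (hm : ∀ j, 1 ≤ m j) (hlac : ∀ j, 3 * m j ≤ m (j + 1)) :
    (∀ (j j' : ℕ), 1 ≤ j → 1 ≤ j' →
      ∀ (ξ : Fin (j - 1) → Fin 3) (ξ' : Fin (j' - 1) → Fin 3),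
        (latticePt m j ξ = latticePt m j' ξ' →
          j = j' ∧ ∀ (l : ℕ) (h : l < j - 1) (h' : l < j' - 1), ξ ⟨l, h⟩ = ξ' ⟨l, h'⟩) ∧
        latticePt m j ξ ≠ -latticePt m j' ξ' ∧
        latticePt m j ξ ≠ 0) ∧
    (∀ n : ℕ, 1 ≤ n → ∀ s t : ℝ,
      (∏ j ∈ Finset.Icc 1 n,
          ((1 + Real.cos (2 * π * (m j : ℝ) * ((-1 : ℝ) ^ (j - 1) * s + t)) : ℝ) : ℂ))
        = 1 + ∑ j ∈ Finset.Icc 1 n, ∑ ξ : Fin (j - 1) → Fin 3, ∑ σ ∈ ({-1, 1} : Finset ℤ),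
            (1 / 2 : ℂ) ^ (1 + nzCount ξ) *
              Complex.exp (2 * (π : ℂ) * Complex.I *
                (((σ • latticePt m j ξ).1 : ℂ) * (s : ℂ) +
                  ((σ • latticePt m j ξ).2 : ℂ) * (t : ℂ)))) := by
  refine ⟨fun j j' hj hj' ξ ξ' => ⟨fun h => ?_, fun h => ?_, fun h => ?_⟩, fun n _ s t => ?_⟩
  · obtain rfl : j = j' := le_antisymm (index_le_of_latticePt_eq hm hlac hj' hj h.symm)
      (index_le_of_latticePt_eq hm hlac hj hj' h)
    obtain rfl := latticePt_injective hm hlac j h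
    exact ⟨rfl, fun _ _ _ => rfl⟩
  · have h1 := (latticePt_snd_mem hm hlac hj ξ).1
    have h2 := (latticePt_snd_mem hm hlac hj' ξ').1
    rw [h, Prod.snd_neg] at h1
    omega
  · have h1 := (latticePt_snd_mem hm hlac hj ξ).1
    rw [h, Prod.snd_zero] at h1
    omega
  · simp_rw [← expChar_apply, sum_expChar_smul_latticePt, Complex.ofReal_add,
      Complex.ofReal_one, cos_eq_expChar]
    exact prod_Icc_one_add
      (fun j => (expChar s t (baseVec m j) + expChar s t (-baseVec m j)) / 2) n

end
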